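/- Under Assumption (EF), suppose there exists an admissible strategy h ∈ H_{K,A} such that h_T(ω) = 0 for all ω ∈ Ω and h_{t−1}(ω̄) − h_t(ω̄) ∈ int K_t(ω̄) for some t ∈ I and some ω̄ ∈ Ω. Then there exists an arbitrage strategy ĥ ∈ H_{K,A}. -/

import Mathlib

open Set MeasureTheory Pointwise

namespace MSPPaper

section Defs

variable {Ω E : Type*}

/-- A finitely supported probability measure on `Ω`: finite support, strictly
positive weights on the support, total mass one. -/
structure FinProb (Ω : Type*) where
  supp : Finset Ω
  w : Ω → ℝ
  pos : ∀ ω ∈ supp, 0 < w ω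
  zero : ∀ ω ∉ supp, w ω = 0
  sum_one : ∑ ω ∈ supp, w ω = 1

/-- The measure of a set under a finitely supported probability. -/
noncomputable def FinProb.meas (Q : FinProb Ω) (A : Set Ω) : ℝ :=
  letI := Classical.decPred fun ω => ω ∈ A
  ∑ ω ∈ Q.supp.filter (fun ω => ω ∈ A), Q.w ω

/-- The level set `Σ_t^ω` of the process `ψ`. -/
def level (ψ : ℕ → Ω → E) (t : ℕ) (ω : Ω) : Set Ω :=
  {ω' | ∀ s ≤ t, ψ s ω' = ψ s ω}

/-- The conditional expectation `E_Q[ξ | F_t](ω)`. -/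
noncomputable def condExp {F : Type*} [AddCommMonoid F] [Module ℝ F]
    (ψ : ℕ → Ω → E) (t : ℕ) (Q : FinProb Ω) (ξ : Ω → F) (ω : Ω) : F :=
  letI := Classical.decPred fun ω' => ω' ∈ level ψ t ω
  (Q.meas (level ψ t ω))⁻¹ •
    ∑ ω' ∈ Q.supp.filter (fun ω' => ω' ∈ level ψ t ω), Q.w ω' • ξ ω'

variable [MeasurableSpace E]

/-- The natural filtration `F̂_t` generated by `ψ_0, …, ψ_t`. -/
def natFilt (ψ : ℕ → Ω → E) (t : ℕ) : MeasurableSpace Ω :=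
  ⨆ s ∈ Finset.range (t + 1), MeasurableSpace.comap (ψ s) inferInstance

/-- The `P`-null sets relative to `F̂_t`. -/
def nullSets (ψ : ℕ → Ω → E) (P : FinProb Ω) (t : ℕ) : Set (Set Ω) :=
  {A | ∃ A', A ⊆ A' ∧ MeasurableSet[natFilt ψ t] A' ∧ P.meas A' = 0}

/-- The completed filtration `F_t`. -/
def filt (ψ : ℕ → Ω → E) (t : ℕ) : MeasurableSpace Ω :=
  ⨅ P : FinProb Ω,
    MeasurableSpace.generateFrom ({A | MeasurableSet[natFilt ψ t] A} ∪ nullSets ψ P t)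

/-- `G`-measurability of a correspondence. -/
def CorrMeasurable {F : Type*} [TopologicalSpace F]
    (G : MeasurableSpace Ω) (U : Ω → Set F) : Prop :=
  ∀ O : Set F, IsOpen O → MeasurableSet[G] {ω | (U ω ∩ O).Nonempty}

/-- The set `L(G; U)` of `G`-measurable selections of `U`. -/
def Selections {F : Type*} [MeasurableSpace F]
    (G : MeasurableSpace Ω) (U : Ω → Set F) : Set (Ω → F) :=
  {ξ | Measurable[G] ξ ∧ ∀ ω, ξ ω ∈ U ω}

/-- The correspondence `U^♯` (taken at stage `t`). -/
def sharp {d : ℕ} (ψ : ℕ → Ω → E) (t : ℕ) (U : Ω → Set (Fin d → ℝ)) (ω : Ω) :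
    Set (Fin d → ℝ) :=
  convexHull ℝ (⋃ ω' ∈ level ψ t ω, U ω')

/-- The correspondence `U^♭` (taken at stage `t`). -/
def flat {d : ℕ} (ψ : ℕ → Ω → E) (t : ℕ) (U : Ω → Set (Fin d → ℝ)) (ω : Ω) :
    Set (Fin d → ℝ) :=
  ⋂ ω' ∈ level ψ t ω, ⋃ l ∈ Ioo (0 : ℝ) 1, (l • U ω' + (1 - l) • sharp ψ t U ω)

/-- The backward iteration defining `W`, indexed from the terminal date. -/
def Wrev {d : ℕ} (ψ : ℕ → Ω → E) (T : ℕ) (V C : ℕ → Ω → Set (Fin d → ℝ)) :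
    ℕ → Ω → Set (Fin d → ℝ)
  | 0 => V T
  | (k + 1) => fun ω =>
      V (T - (k + 1)) ω ∩
        (flat ψ (T - (k + 1)) (Wrev ψ T V C k) ω - C (T - (k + 1)) ω)

/-- The sequence `W_t`: `W_T = V_T` and `W_t = V_t ∩ (W_{t+1}^♭ − C_t)` for `t < T`. -/
def W {d : ℕ} (ψ : ℕ → Ω → E) (T : ℕ) (V C : ℕ → Ω → Set (Fin d → ℝ)) (t : ℕ) :
    Ω → Set (Fin d → ℝ) :=
  Wrev ψ T V C (T - t)

/-- The defining hypotheses of a martingale selection problem `(V, C)`: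
adapted measurable correspondences, `V_t(ω)` convex and relatively open,
`C_t(ω)` closed and convex. -/
def IsMSP {d : ℕ} (ψ : ℕ → Ω → E) (T : ℕ) (V C : ℕ → Ω → Set (Fin d → ℝ)) : Prop :=
  ∀ t ≤ T,
    CorrMeasurable (filt ψ t) (V t) ∧ CorrMeasurable (filt ψ t) (C t) ∧
    ∀ ω : Ω, Convex ℝ (V t ω) ∧ V t ω = intrinsicInterior ℝ (V t ω) ∧
      IsClosed (C t ω) ∧ Convex ℝ (C t ω)

/-- `(ξ, Q)` is a solution of the martingale selection problem `(V, C)`. -/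
def IsSolution {d : ℕ} (ψ : ℕ → Ω → E) (T : ℕ) (V C : ℕ → Ω → Set (Fin d → ℝ))
    (ξ : ℕ → Ω → (Fin d → ℝ)) (Q : FinProb Ω) : Prop :=
  (∀ t ≤ T, ξ t ∈ Selections (filt ψ t) (V t)) ∧
  (∀ t, t + 1 ≤ T → ∀ ω ∈ Q.supp, condExp ψ t Q (ξ (t + 1)) ω - ξ t ω ∈ C t ω)

/-- Solvability of the martingale selection problem: a local solution exists at
every point of `Ω`. -/
def Solvable {d : ℕ} (ψ : ℕ → Ω → E) (T : ℕ) (V C : ℕ → Ω → Set (Fin d → ℝ)) : Prop :=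
  ∀ ωb : Ω, ∃ (ξ : ℕ → Ω → (Fin d → ℝ)) (Q : FinProb Ω),
    ωb ∈ Q.supp ∧ IsSolution ψ T V C ξ Q

/-- The positive polar cone of a subset of `ℝ^d`. -/
def polar {d : ℕ} (B : Set (Fin d → ℝ)) : Set (Fin d → ℝ) :=
  {y | ∀ x ∈ B, 0 ≤ ∑ i, y i * x i}

/-- A closed convex cone (containing the origin). -/
def IsClosedConvexCone {F : Type*} [TopologicalSpace F] [AddCommMonoid F] [Module ℝ F]
    (A : Set F) : Prop :=
  IsClosed A ∧ Convex ℝ A ∧ (0 : F) ∈ A ∧ ∀ c : ℝ, 0 < c → ∀ x ∈ A, c • x ∈ A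

end Defs

section KabanovDefs

variable {Ω E : Type*} [MeasurableSpace E]

/-- Admissible (self-financing, constrained) strategies in the Kabanov model,
with the convention `h_{-1} = 0`. -/
def Admissible {d : ℕ} (ψ : ℕ → Ω → E) (T : ℕ) (K A : ℕ → Ω → Set (Fin d → ℝ))
    (h : ℕ → Ω → (Fin d → ℝ)) : Prop :=
  (∀ t ≤ T, h t ∈ Selections (filt ψ t) (A t)) ∧
  (∀ ω, -h 0 ω ∈ K 0 ω) ∧
  (∀ t, t + 1 ≤ T → ∀ ω, h t ω - h (t + 1) ω ∈ K (t + 1) ω)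

/-- An arbitrage strategy in the Kabanov model. -/
def IsArbitrage {d : ℕ} (ψ : ℕ → Ω → E) (T : ℕ) (K A : ℕ → Ω → Set (Fin d → ℝ))
    (h : ℕ → Ω → (Fin d → ℝ)) : Prop :=
  Admissible ψ T K A h ∧ (∀ ω, ∀ i, 0 ≤ h T ω i) ∧ ∃ ω, h T ω ≠ 0

/-- Weak no-arbitrage `NA^w` for the market `(K, A)`. -/
def NAw {d : ℕ} (ψ : ℕ → Ω → E) (T : ℕ) (K A : ℕ → Ω → Set (Fin d → ℝ)) : Prop :=
  ¬ ∃ h : ℕ → Ω → (Fin d → ℝ), IsArbitrage ψ T K A h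

/-- The cone `Khat` dominates the cone `K0`. -/
def ConeDominates {d : ℕ} (K0 Khat : Set (Fin d → ℝ)) : Prop :=
  K0 \ (K0 ∩ -K0) ⊆ intrinsicInterior ℝ Khat

/-- The market `(Khat, A)` dominates the market `(K, A)`. -/
def MarketDominates {d : ℕ} (T : ℕ) (Khat K : ℕ → Ω → Set (Fin d → ℝ)) : Prop :=
  ∀ t ≤ T, ∀ ω : Ω, ConeDominates (K t ω) (Khat t ω)

/-- Robust no-arbitrage `NA^r`: some dominating market satisfies `NA^w`. -/
def NAr {d : ℕ} (ψ : ℕ → Ω → E) (T : ℕ) (K A : ℕ → Ω → Set (Fin d → ℝ)) : Prop :=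
  ∃ Khat : ℕ → Ω → Set (Fin d → ℝ),
    (∀ t ≤ T, CorrMeasurable (filt ψ t) (Khat t)) ∧
    (∀ t ≤ T, ∀ ω, IsClosedConvexCone (Khat t ω)) ∧
    MarketDominates T Khat K ∧ NAw ψ T Khat A

/-- Assumption (EF): free disposal and availability of a nonzero nonnegative
admissible position. -/
def AssumptionEF {d : ℕ} (T : ℕ) (K A : ℕ → Ω → Set (Fin d → ℝ)) : Prop :=
  ∀ t ≤ T, ∀ ω : Ω,
    ({x : Fin d → ℝ | (∀ i, 0 ≤ x i) ∧ x ≠ 0} ⊆ interior (K t ω)) ∧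
    ∃ x ∈ A t ω, (∀ i, 0 ≤ x i) ∧ x ≠ 0

/-- Assumption (RO): either no constraints, or efficient friction. -/
def AssumptionRO {d : ℕ} (T : ℕ) (K A : ℕ → Ω → Set (Fin d → ℝ)) : Prop :=
  (∀ t ≤ T, ∀ ω : Ω, A t ω = Set.univ) ∨
  (∀ t ≤ T, ∀ ω : Ω, K t ω ∩ -K t ω = {0})

/-- Solvability of the martingale selection problem `(V, C)` (spelled out). -/
def MSPSolvable {d : ℕ} (ψ : ℕ → Ω → E) (T : ℕ)
    (V C : ℕ → Ω → Set (Fin d → ℝ)) : Prop :=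
  ∀ ωb : Ω, ∃ (ξ : ℕ → Ω → (Fin d → ℝ)) (Q : FinProb Ω), ωb ∈ Q.supp ∧
    (∀ t ≤ T, ξ t ∈ Selections (filt ψ t) (V t)) ∧
    (∀ t, t + 1 ≤ T → ∀ ω ∈ Q.supp, condExp ψ t Q (ξ (t + 1)) ω - ξ t ω ∈ C t ω)

end KabanovDefs

section Filtration

variable {Ω E : Type*}

theorem mem_level_symm {ψ : ℕ → Ω → E} {t : ℕ} {ω ω' : Ω} (h : ω' ∈ level ψ t ω) :
    ω ∈ level ψ t ω' :=
  fun s hs => (h s hs).symm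

theorem level_antitone {ψ : ℕ → Ω → E} (ω : Ω) : Antitone fun t => level ψ t ω :=
  fun _ _ hst _ h r hr => h r (hr.trans hst)

/-- The uniform probability on a nonempty finite set. -/
noncomputable def FinProb.uniform (S : Finset Ω) (hS : S.Nonempty) : FinProb Ω :=
  letI := Classical.decPred fun ω => ω ∈ S
  { supp := S
    w := fun ω => if ω ∈ S then (S.card : ℝ)⁻¹ else 0
    pos := fun ω hω => by
      have : (0 : ℝ) < S.card := by exact_mod_cast hS.card_pos
      simp only [if_pos hω]
      positivity
    zero := fun ω hω => if_neg hω
    sum_one := by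
      have : (S.card : ℝ) ≠ 0 := by exact_mod_cast hS.card_pos.ne'
      rw [Finset.sum_congr rfl fun ω hω => if_pos hω]
      simp [this] }

theorem FinProb.meas_eq_zero_iff (P : FinProb Ω) (A : Set Ω) :
    P.meas A = 0 ↔ ∀ ω ∈ P.supp, ω ∉ A := by
  classical
  unfold FinProb.meas
  rw [Finset.sum_eq_zero_iff_of_nonneg fun ω hω => (P.pos ω (Finset.mem_filter.1 hω).1).le]
  simp only [Finset.mem_filter]
  exact ⟨fun h ω hω hA => (P.pos ω hω).ne' (h ω ⟨hω, hA⟩), fun h ω hω => absurd hω.2 (h ω hω.1)⟩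

/-- The σ-algebra of sets that do not separate two given points. -/
@[reducible]
def nonseparating (ω ω' : Ω) : MeasurableSpace Ω where
  MeasurableSet' A := ω ∈ A ↔ ω' ∈ A
  measurableSet_empty := Iff.rfl
  measurableSet_compl _ h := not_congr h
  measurableSet_iUnion f h := by
    simp only [mem_iUnion]
    exact exists_congr h

variable [MeasurableSpace E]

theorem natFilt_le_nonseparating {ψ : ℕ → Ω → E} {t : ℕ} {ω ω' : Ω}
    (h : ω' ∈ level ψ t ω) : natFilt ψ t ≤ nonseparating ω ω' := by
  refine iSup₂_le fun s hs => ?_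
  rintro _ ⟨B, -, rfl⟩
  change ψ s ω ∈ B ↔ ψ s ω' ∈ B
  rw [h s (Nat.lt_succ_iff.1 (Finset.mem_range.1 hs))]

theorem filt_le_nonseparating {ψ : ℕ → Ω → E} {t : ℕ} {ω ω' : Ω}
    (h : ω' ∈ level ψ t ω) : filt ψ t ≤ nonseparating ω ω' := by
  classical
  refine (iInf_le _ (FinProb.uniform {ω, ω'} (Finset.insert_nonempty _ _))).trans
    (MeasurableSpace.generateFrom_le ?_)
  rintro A (hA | ⟨A', hAA', -, hA'⟩)
  · exact natFilt_le_nonseparating h A hA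
  · rw [FinProb.meas_eq_zero_iff] at hA'
    have h1 : ω ∉ A' := hA' ω (Finset.mem_insert_self _ _)
    have h2 : ω' ∉ A' := hA' ω' (Finset.mem_insert_of_mem (Finset.mem_singleton_self _))
    exact iff_of_false (fun hx => h1 (hAA' hx)) fun hx => h2 (hAA' hx)

theorem measurableSet_level [MeasurableSingletonClass E] (ψ : ℕ → Ω → E) (t : ℕ) (ω : Ω) :
    MeasurableSet[natFilt ψ t] (level ψ t ω) := by
  have : level ψ t ω = ⋂ s ∈ Finset.range (t + 1), ψ s ⁻¹' {ψ s ω} := by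
    ext x
    simp [level]
  rw [this]
  refine MeasurableSet.biInter (Finset.range (t + 1)).countable_toSet fun s hs => ?_
  have hle : MeasurableSpace.comap (ψ s) inferInstance ≤ natFilt ψ t :=
    le_iSup₂_of_le (f := fun s (_ : s ∈ Finset.range (t + 1)) =>
      MeasurableSpace.comap (ψ s) inferInstance) s hs le_rfl
  exact hle _ ⟨_, measurableSet_singleton _, rfl⟩

/-- The sets of the completed filtration are the unions of level sets. -/
theorem measurableSet_filt_iff [MeasurableSingletonClass E] {ψ : ℕ → Ω → E} {t : ℕ}
    {A : Set Ω} :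
    MeasurableSet[filt ψ t] A ↔ ∀ ω, ∀ ω' ∈ level ψ t ω, (ω ∈ A ↔ ω' ∈ A) := by
  refine ⟨fun hA ω ω' h => filt_le_nonseparating h A hA, fun hA => ?_⟩
  refine MeasurableSpace.measurableSet_iInf.2 fun P => ?_
  set G := MeasurableSpace.generateFrom ({A | MeasurableSet[natFilt ψ t] A} ∪ nullSets ψ P t)
  have hG : natFilt ψ t ≤ G :=
    fun B hB => MeasurableSpace.measurableSet_generateFrom (Or.inl hB)
  set B : Set Ω := ⋃ ω ∈ P.supp, level ψ t ω
  have hB : MeasurableSet[natFilt ψ t] B :=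
    MeasurableSet.biUnion P.supp.countable_toSet fun ω _ => measurableSet_level ψ t ω
  have hinter : MeasurableSet[G] (A ∩ B) := by
    have : A ∩ B = ⋃ ω ∈ {ω | ω ∈ P.supp ∧ ω ∈ A}, level ψ t ω := by
      ext x
      simp only [B, mem_inter_iff, mem_iUnion, mem_ofPred_eq, exists_prop]
      constructor
      · rintro ⟨hx, ω, hω, hxω⟩
        exact ⟨ω, ⟨hω, (hA ω x hxω).2 hx⟩, hxω⟩
      · rintro ⟨ω, ⟨hω, hωA⟩, hxω⟩
        exact ⟨(hA ω x hxω).1 hωA, ω, hω, hxω⟩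
    rw [this]
    exact MeasurableSet.biUnion (P.supp.countable_toSet.mono fun ω hω => hω.1)
      fun ω _ => hG _ (measurableSet_level ψ t ω)
  have hdiff : MeasurableSet[G] (A \ B) := by
    refine MeasurableSpace.measurableSet_generateFrom
      (Or.inr ⟨Bᶜ, fun x hx => hx.2, MeasurableSet.compl hB, ?_⟩)
    rw [FinProb.meas_eq_zero_iff]
    exact fun ω hω hωB => hωB (mem_iUnion₂.2 ⟨ω, hω, fun _ _ => rfl⟩)
  rw [← inter_union_sdiff A B]
  exact MeasurableSet.union hinter hdiff

theorem measurable_filt_iff [MeasurableSingletonClass E] {F : Type*} [MeasurableSpace F]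
    [MeasurableSingletonClass F] {ψ : ℕ → Ω → E} {t : ℕ} {ξ : Ω → F} :
    Measurable[filt ψ t] ξ ↔ ∀ ω, ∀ ω' ∈ level ψ t ω, ξ ω' = ξ ω := by
  constructor
  · intro hξ ω ω' h
    exact (measurableSet_filt_iff.1 (hξ (measurableSet_singleton (ξ ω))) ω ω' h).1 rfl
  · intro hξ B _
    refine measurableSet_filt_iff.2 fun ω ω' h => ?_
    rw [mem_preimage, mem_preimage, hξ ω ω' h]

/-- A measurable closed-valued correspondence is constant on level sets. -/
theorem CorrMeasurable.eq_of_mem_level {F : Type*} [TopologicalSpace F] {ψ : ℕ → Ω → E} {t : ℕ}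
    {U : Ω → Set F} (hU : CorrMeasurable (filt ψ t) U) (hclosed : ∀ ω, IsClosed (U ω))
    {ω ω' : Ω} (h : ω' ∈ level ψ t ω) : U ω' = U ω := by
  have key : ∀ {ω ω' : Ω}, ω' ∈ level ψ t ω → U ω' ⊆ U ω := by
    intro ω ω' h x hx
    by_contra hxω
    have := (filt_le_nonseparating h _ (hU _ (hclosed ω).isOpen_compl)).2 ⟨x, hx, hxω⟩
    obtain ⟨y, hy, hy'⟩ := this
    exact hy' hy
  exact (key h).antisymm (key (mem_level_symm h))

end Filtration

section Cones

variable {F : Type*} [TopologicalSpace F] [AddCommGroup F] [Module ℝ F]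

theorem IsClosedConvexCone.add_mem {C : Set F} (hC : IsClosedConvexCone C) {x y : F}
    (hx : x ∈ C) (hy : y ∈ C) : x + y ∈ C := by
  have := hC.2.2.2 2 two_pos _
    (hC.2.1 hx hy (by norm_num : (0 : ℝ) ≤ 1 / 2) (by norm_num : (0 : ℝ) ≤ 1 / 2) (by norm_num))
  rwa [smul_add, smul_smul, smul_smul, show (2 : ℝ) * (1 / 2) = 1 by norm_num, one_smul,
    one_smul] at this

theorem IsClosedConvexCone.add_mem_interior [ContinuousAdd F] {C : Set F}
    (hC : IsClosedConvexCone C) {x y : F} (hx : x ∈ interior C) (hy : y ∈ C) :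
    x + y ∈ interior C := by
  have hsub : (Homeomorph.addRight y) '' interior C ⊆ interior C := by
    refine interior_maximal ?_ ((Homeomorph.addRight y).isOpenMap _ isOpen_interior)
    rintro _ ⟨z, hz, rfl⟩
    exact hC.add_mem (interior_subset hz) hy
  exact hsub ⟨x, hx, rfl⟩

theorem exists_pos_sub_smul_mem [IsTopologicalAddGroup F] [ContinuousSMul ℝ F] {C : Set F}
    {v : F} (hv : v ∈ interior C) (x : F) : ∃ c : ℝ, 0 < c ∧ v - c • x ∈ C := by
  have hcont : Continuous fun c : ℝ => v - c • x := by fun_prop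
  have hnhds : ∀ᶠ c : ℝ in nhds 0, v - c • x ∈ C :=
    hcont.continuousAt.eventually_mem (by simpa using mem_interior_iff_mem_nhds.1 hv)
  obtain ⟨c, hc, hcpos⟩ :=
    ((hnhds.filter_mono nhdsWithin_le_nhds).and
      (self_mem_nhdsWithin : Ioi (0 : ℝ) ∈ nhdsWithin 0 (Ioi 0))).exists
  exact ⟨c, hcpos, hc⟩

end Cones

section Surplus

variable {d : ℕ}

open Classical in
/-- A nonzero nonnegative position in `A` affordable from `v` under the solvency cone `K`,
or `0` if there is none. -/
noncomputable def surplus (K A : Set (Fin d → ℝ)) (v : Fin d → ℝ) : Fin d → ℝ :=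
  if h : ∃ x ∈ A, (∀ i, 0 ≤ x i) ∧ x ≠ 0 ∧ v - x ∈ K then h.choose else 0

theorem surplus_nonneg (K A : Set (Fin d → ℝ)) (v : Fin d → ℝ) (i : Fin d) :
    0 ≤ surplus K A v i := by
  unfold surplus
  split_ifs with h
  · exact h.choose_spec.2.1 i
  · exact le_rfl

theorem surplus_mem {K A : Set (Fin d → ℝ)} (hA : 0 ∈ A) (v : Fin d → ℝ) :
    surplus K A v ∈ A := by
  unfold surplus
  split_ifs with h
  · exact h.choose_spec.1
  · exact hA

theorem sub_surplus_mem {K A : Set (Fin d → ℝ)} {v : Fin d → ℝ} (hv : v ∈ K) :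
    v - surplus K A v ∈ K := by
  unfold surplus
  split_ifs with h
  · exact h.choose_spec.2.2.2
  · rwa [sub_zero]

theorem surplus_ne_zero {K A : Set (Fin d → ℝ)} (hA : IsClosedConvexCone A)
    (hpos : ∃ x ∈ A, (∀ i, 0 ≤ x i) ∧ x ≠ 0) {v : Fin d → ℝ} (hv : v ∈ interior K) :
    surplus K A v ≠ 0 := by
  obtain ⟨x, hxA, hx, hx0⟩ := hpos
  obtain ⟨c, hc, hcK⟩ := exists_pos_sub_smul_mem hv x
  have h : ∃ x ∈ A, (∀ i, 0 ≤ x i) ∧ x ≠ 0 ∧ v - x ∈ K :=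
    ⟨c • x, hA.2.2.2 c hc x hxA, fun i => mul_nonneg hc.le (hx i), smul_ne_zero hc.ne' hx0, hcK⟩
  unfold surplus
  rw [dif_pos h]
  exact h.choose_spec.2.2.1

variable {Ω : Type*}

/-- The positions obtained by reinvesting, at each date, whatever the strategy `h` and the
previously accumulated position leave over. -/
noncomputable def surplusProcess (K A : ℕ → Ω → Set (Fin d → ℝ)) (h : ℕ → Ω → (Fin d → ℝ)) :
    ℕ → Ω → (Fin d → ℝ)
  | 0, ω => surplus (K 0 ω) (A 0 ω) (-h 0 ω)
  | (t + 1), ω => surplus (K (t + 1) ω) (A (t + 1) ω)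
      (surplusProcess K A h t ω + (h t ω - h (t + 1) ω))

theorem surplusProcess_nonneg (K A : ℕ → Ω → Set (Fin d → ℝ)) (h : ℕ → Ω → (Fin d → ℝ))
    (t : ℕ) (ω : Ω) (i : Fin d) : 0 ≤ surplusProcess K A h t ω i := by
  cases t <;> exact surplus_nonneg _ _ _ i

end Surplus

/-- Lemma 5.10: a liquidation-to-zero strategy with an increment in the
interior of a solvency cone yields an arbitrage strategy. -/
theorem interior_increment_gives_arbitrage
    {Ω E : Type*}
    [TopologicalSpace Ω] [PolishSpace Ω] [MeasurableSpace Ω] [BorelSpace Ω]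
    [MetricSpace E] [TopologicalSpace.SeparableSpace E] [MeasurableSpace E] [BorelSpace E]
    (ψ : ℕ → Ω → E) (hψ : ∀ t, Measurable (ψ t)) (hψ0 : ∃ e : E, ∀ ω, ψ 0 ω = e)
    (d T : ℕ) (K A : ℕ → Ω → Set (Fin d → ℝ))
    (hKmeas : ∀ t ≤ T, CorrMeasurable (filt ψ t) (K t))
    (hKcone : ∀ t ≤ T, ∀ ω : Ω, IsClosedConvexCone (K t ω))
    (hAmeas : ∀ t ≤ T, CorrMeasurable (filt ψ t) (A t))
    (hAcone : ∀ t ≤ T, ∀ ω : Ω, IsClosedConvexCone (A t ω))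
    (hEF : AssumptionEF T K A)
    (h : ℕ → Ω → (Fin d → ℝ)) (hadm : Admissible ψ T K A h)
    (hT0 : ∀ ω : Ω, h T ω = 0)
    (hint : (∃ ωb : Ω, -h 0 ωb ∈ interior (K 0 ωb)) ∨
      ∃ t, t + 1 ≤ T ∧ ∃ ωb : Ω, h t ωb - h (t + 1) ωb ∈ interior (K (t + 1) ωb)) :
    ∃ hh : ℕ → Ω → (Fin d → ℝ), IsArbitrage ψ T K A hh := by
  set a := surplusProcess K A h with ha
  obtain ⟨hsel, hK0, hKs⟩ := hadm
  have hconst : ∀ t ≤ T, ∀ ω, ∀ ω' ∈ level ψ t ω,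
      h t ω' = h t ω ∧ K t ω' = K t ω ∧ A t ω' = A t ω := fun t ht ω ω' hω =>
    ⟨measurable_filt_iff.1 (hsel t ht).1 ω ω' hω,
      (hKmeas t ht).eq_of_mem_level (fun ω => (hKcone t ht ω).1) hω,
      (hAmeas t ht).eq_of_mem_level (fun ω => (hAcone t ht ω).1) hω⟩
  have haconst : ∀ t ≤ T, ∀ ω, ∀ ω' ∈ level ψ t ω, a t ω' = a t ω := by
    intro t
    induction t with
    | zero =>
      intro ht ω ω' hω
      obtain ⟨e1, e2, e3⟩ := hconst 0 ht ω ω' hω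
      simp only [ha, surplusProcess, e1, e2, e3]
    | succ t ih =>
      intro ht ω ω' hω
      have hω' : ω' ∈ level ψ t ω := level_antitone ω t.le_succ hω
      have ht' : t ≤ T := t.le_succ.trans ht
      obtain ⟨e1, e2, e3⟩ := hconst (t + 1) ht ω ω' hω
      have e4 := (hconst t ht' ω ω' hω').1
      have e5 := ih ht' ω ω' hω'
      rw [ha] at e5
      simp only [ha, surplusProcess, e1, e2, e3, e4, e5]
  have hamem : ∀ t ≤ T, ∀ ω, a t ω ∈ A t ω := by
    intro t ht ω
    cases t <;> exact surplus_mem (hAcone _ ht ω).2.2.1 _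
  have haint : ∀ t, ∀ s ≤ T, ∀ ω, a t ω ≠ 0 → a t ω ∈ interior (K s ω) :=
    fun t s hs ω hne => (hEF s hs ω).1 ⟨surplusProcess_nonneg K A h t ω, hne⟩
  have haK : ∀ t, t + 1 ≤ T → ∀ ω, a t ω ∈ K (t + 1) ω := by
    intro t ht ω
    by_cases h0 : a t ω = 0
    · rw [h0]
      exact (hKcone _ ht ω).2.2.1
    · exact interior_subset (haint t _ ht ω h0)
  have hstep : ∀ t, t + 1 ≤ T → ∀ ω, a t ω ≠ 0 → a (t + 1) ω ≠ 0 := fun t ht ω hne =>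
    surplus_ne_zero (hAcone _ ht ω) (hEF _ ht ω).2
      ((hKcone _ ht ω).add_mem_interior (haint t _ ht ω hne) (hKs t ht ω))
  have hne : ∃ t ≤ T, ∃ ω, a t ω ≠ 0 := by
    rcases hint with ⟨ω, hω⟩ | ⟨t, ht, ω, hω⟩
    · exact ⟨0, T.zero_le, ω, surplus_ne_zero (hAcone _ T.zero_le ω) (hEF _ T.zero_le ω).2 hω⟩
    · refine ⟨t + 1, ht, ω, surplus_ne_zero (hAcone _ ht ω) (hEF _ ht ω).2 ?_⟩
      have := (hKcone _ ht ω).add_mem_interior hω (haK t ht ω)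
      rwa [add_comm (h t ω - h (t + 1) ω)] at this
  obtain ⟨t₀, ht₀, ω₀, hω₀⟩ := hne
  have hTne : ∀ t, t₀ ≤ t → t ≤ T → a t ω₀ ≠ 0 := by
    intro t ht
    induction t, ht using Nat.le_induction with
    | base => exact fun _ => hω₀
    | succ t _ ih => exact fun ht => hstep t ht ω₀ (ih (t.le_succ.trans ht))
  refine ⟨fun t ω => h t ω + a t ω, ⟨fun t ht => ⟨measurable_filt_iff.2 ?_, fun ω => ?_⟩,
    fun ω => ?_, fun t ht ω => ?_⟩, fun ω i => ?_, ω₀, ?_⟩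
  · intro ω ω' hω
    simp only [(hconst t ht ω ω' hω).1, haconst t ht ω ω' hω]
  · exact (hAcone t ht ω).add_mem ((hsel t ht).2 ω) (hamem t ht ω)
  · have := sub_surplus_mem (A := A 0 ω) (hK0 ω)
    rwa [← neg_add'] at this
  · have := sub_surplus_mem (A := A (t + 1) ω)
      ((hKcone _ ht ω).add_mem (haK t ht ω) (hKs t ht ω))
    have e : h t ω + a t ω - (h (t + 1) ω + a (t + 1) ω)
        = a t ω + (h t ω - h (t + 1) ω) - a (t + 1) ω := by abel
    rw [e]
    exact this
  · simp only [hT0, zero_add]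
    exact surplusProcess_nonneg K A h T ω i
  · simp only [hT0, zero_add]
    exact hTne T ht₀ le_rfl

end MSPPaper
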